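/- Let X⁽¹⁾, …, X⁽ᵖ⁾ be arbitrary N×N matrices over A (no relations assumed), with copies X⁽ʲ⁾_{⟨1⟩} = X⁽ʲ⁾ ⊗ I^{⊗(n−1)} and X⁽ʲ⁾_{⟨r+1⟩} = R_r X⁽ʲ⁾_{⟨r⟩} R_r⁻¹. Then for all k ≥ 1 the shift identity X⁽¹⁾_{⟨k+1⟩} X⁽²⁾_{⟨k+2⟩} ⋯ X⁽ᵖ⁾_{⟨k+p⟩} = R_{k→(k+p−1)} · X⁽¹⁾_{⟨k⟩} X⁽²⁾_{⟨k+1⟩} ⋯ X⁽ᵖ⁾_{⟨k+p−1⟩} · R⁻¹_{(k+p−1)→k} holds; it depends only on the braid relation for R and not on any algebraic properties of the matrices X⁽ʲ⁾. -/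

import Mathlib

open scoped BigOperators

noncomputable section

/-- One-site embedding of an `N×N` matrix into `Mat_{N^k}` at 0-based position `i`
(the paper's `X_{i+1}` in 1-based numbering).  Out of range we return the identity. -/
def matAt {α : Type*} [Semiring α] (N k : ℕ) (X : Matrix (Fin N) (Fin N) α) (i : ℕ) :
    Matrix (Fin k → Fin N) (Fin k → Fin N) α :=
  if h : i < k then
    Matrix.of fun a b =>
      if ∀ l : Fin k, (l : ℕ) ≠ i → a l = b l then X (a ⟨i, h⟩) (b ⟨i, h⟩) else 0
  else 1

/-- Two-site embedding of an operator on `V⊗V` into `Mat_{N^k}` at 0-based positions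
`i, i+1` (the paper's `R_{i+1}` in 1-based numbering). -/
def opAt {α : Type*} [Semiring α] (N k : ℕ)
    (R : Matrix (Fin N × Fin N) (Fin N × Fin N) α) (i : ℕ) :
    Matrix (Fin k → Fin N) (Fin k → Fin N) α :=
  if h : i + 1 < k then
    Matrix.of fun a b =>
      if ∀ l : Fin k, (l : ℕ) ≠ i → (l : ℕ) ≠ i + 1 → a l = b l then
        R (a ⟨i, by omega⟩, a ⟨i + 1, h⟩) (b ⟨i, by omega⟩, b ⟨i + 1, h⟩)
      else 0
  else 1

/-- A numeric (complex) matrix viewed inside `Mat(A)` via the unit of `A`. -/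
def toA (A : Type*) [Semiring A] [Algebra ℂ A] {ι : Type*} (X : Matrix ι ι ℂ) :
    Matrix ι ι A :=
  X.map (algebraMap ℂ A)

/-- The braid relation `R₁R₂R₁ = R₂R₁R₂` on `V^{⊗3}`. -/
def IsBraid (N : ℕ) (R : Matrix (Fin N × Fin N) (Fin N × Fin N) ℂ) : Prop :=
  opAt N 3 R 0 * opAt N 3 R 1 * opAt N 3 R 0 = opAt N 3 R 1 * opAt N 3 R 0 * opAt N 3 R 1

/-- The Hecke condition `(q·I − R)(q⁻¹·I + R) = 0`. -/
def IsHecke (N : ℕ) (q : ℂ) (R : Matrix (Fin N × Fin N) (Fin N × Fin N) ℂ) : Prop :=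
  (q • (1 : Matrix (Fin N × Fin N) (Fin N × Fin N) ℂ) - R) * (q⁻¹ • 1 + R) = 0

/-- `q` is generic: `q ∉ {0, 1, −1}` and `qⁿ ≠ 1` for all positive integers `n`. -/
def GenericQ (q : ℂ) : Prop :=
  q ≠ 0 ∧ q ≠ 1 ∧ q ≠ -1 ∧ ∀ n : ℕ, 0 < n → q ^ n ≠ 1

/-- The reflection-equation type relation `R X₁ R X₁ = X₁ R X₁ R` in `Mat_{N²}`. -/
def RErel {α : Type*} [Semiring α] (N : ℕ)
    (R : Matrix (Fin N × Fin N) (Fin N × Fin N) α) (X : Matrix (Fin N) (Fin N) α) : Prop :=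
  opAt N 2 R 0 * matAt N 2 X 0 * opAt N 2 R 0 * matAt N 2 X 0 =
    matAt N 2 X 0 * opAt N 2 R 0 * matAt N 2 X 0 * opAt N 2 R 0

/-- The quantum-double permutation relation `D₁ R M₁ R = R M₁ R⁻¹ D₁ + R` in `Mat_{N²}(A)`. -/
def PermRel {A : Type*} [Ring A] [Algebra ℂ A] (N : ℕ)
    (R Rinv : Matrix (Fin N × Fin N) (Fin N × Fin N) ℂ)
    (M D : Matrix (Fin N) (Fin N) A) : Prop :=
  matAt N 2 D 0 * opAt N 2 (toA A R) 0 * matAt N 2 M 0 * opAt N 2 (toA A R) 0 =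
    opAt N 2 (toA A R) 0 * matAt N 2 M 0 * opAt N 2 (toA A Rinv) 0 * matAt N 2 D 0 +
      opAt N 2 (toA A R) 0

/-- The homogeneous permutation relation `D₁ R M₁ R = R M₁ R⁻¹ D₁` in `Mat_{N²}(A)`. -/
def PermRelHom {A : Type*} [Ring A] [Algebra ℂ A] (N : ℕ)
    (R Rinv : Matrix (Fin N × Fin N) (Fin N × Fin N) ℂ)
    (M D : Matrix (Fin N) (Fin N) A) : Prop :=
  matAt N 2 D 0 * opAt N 2 (toA A R) 0 * matAt N 2 M 0 * opAt N 2 (toA A R) 0 =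
    opAt N 2 (toA A R) 0 * matAt N 2 M 0 * opAt N 2 (toA A Rinv) 0 * matAt N 2 D 0

/-- Overline copies: `ovCopy … r = X_{⟨r+1⟩}`, i.e. `X_{⟨1⟩} = X⊗I⊗⋯⊗I` and
`X_{⟨r+1⟩} = R_r X_{⟨r⟩} R_r⁻¹`. -/
def ovCopy {α : Type*} [Semiring α] (N k : ℕ)
    (R Rinv : Matrix (Fin N × Fin N) (Fin N × Fin N) α)
    (X : Matrix (Fin N) (Fin N) α) : ℕ → Matrix (Fin k → Fin N) (Fin k → Fin N) α
  | 0 => matAt N k X 0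
  | r + 1 => opAt N k R r * ovCopy N k R Rinv X r * opAt N k Rinv r

/-- Underline copies: `unCopy … r = X_{[r+1]}`, i.e. `X_{[1]} = X⊗I⊗⋯⊗I` and
`X_{[r+1]} = R_r⁻¹ X_{[r]} R_r`. -/
def unCopy {α : Type*} [Semiring α] (N k : ℕ)
    (R Rinv : Matrix (Fin N × Fin N) (Fin N × Fin N) α)
    (X : Matrix (Fin N) (Fin N) α) : ℕ → Matrix (Fin k → Fin N) (Fin k → Fin N) α
  | 0 => matAt N k X 0
  | r + 1 => opAt N k Rinv r * unCopy N k R Rinv X r * opAt N k R r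

/-- `X_{⟨1→n⟩} = X_{⟨1⟩}X_{⟨2⟩}⋯X_{⟨n⟩}`. -/
def ovProd {α : Type*} [Semiring α] (N k : ℕ)
    (R Rinv : Matrix (Fin N × Fin N) (Fin N × Fin N) α)
    (X : Matrix (Fin N) (Fin N) α) (n : ℕ) : Matrix (Fin k → Fin N) (Fin k → Fin N) α :=
  ((List.range n).map (ovCopy N k R Rinv X)).prod

/-- `X_{⟨n→1⟩} = X_{⟨n⟩}X_{⟨n−1⟩}⋯X_{⟨1⟩}`. -/
def ovProdRev {α : Type*} [Semiring α] (N k : ℕ)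
    (R Rinv : Matrix (Fin N × Fin N) (Fin N × Fin N) α)
    (X : Matrix (Fin N) (Fin N) α) (n : ℕ) : Matrix (Fin k → Fin N) (Fin k → Fin N) α :=
  ((List.range n).reverse.map (ovCopy N k R Rinv X)).prod

/-- Shifted Jucys–Murphy matrices: `JMup … R n s = J_{s+1}^{↑n}`, i.e. `J₁^{↑n} = I` and
`J_{s+1}^{↑n} = R_{n+s} J_s^{↑n} R_{n+s}` (paper's 1-based `R_{n+s}` is `opAt … (n+s-1)`).
Applying it to `R⁻¹` produces `(J_{s+1}^{↑n})⁻¹`. -/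
def JMup {α : Type*} [Semiring α] (N k : ℕ)
    (R : Matrix (Fin N × Fin N) (Fin N × Fin N) α) (n : ℕ) :
    ℕ → Matrix (Fin k → Fin N) (Fin k → Fin N) α
  | 0 => 1
  | s + 1 => opAt N k R (n + s) * JMup N k R n s * opAt N k R (n + s)

/-- The quantum trace `Tr_{R(1…n)}(X) = Tr(C₁C₂⋯C_n X)`. -/
def qTr {α : Type*} [Semiring α] (N n : ℕ) (C : Matrix (Fin N) (Fin N) α)
    (X : Matrix (Fin n → Fin N) (Fin n → Fin N) α) : α :=
  Matrix.trace (((List.range n).map (matAt N n C)).prod * X)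

/-- The matrix `C`, `C_i^j = Σ_k Ψ_{ik}^{jk}`. -/
def traceMat (N : ℕ) (Ψ : Matrix (Fin N × Fin N) (Fin N × Fin N) ℂ) :
    Matrix (Fin N) (Fin N) ℂ :=
  Matrix.of fun i j => ∑ k, Ψ (i, k) (j, k)

/-- Skew-invertibility of `R`: `Tr₂(R₁₂Ψ₂₃) = Tr₂(Ψ₁₂R₂₃) = P₁₃`, written componentwise. -/
def SkewInv (N : ℕ) (R Ψ : Matrix (Fin N × Fin N) (Fin N × Fin N) ℂ) : Prop :=
  (∀ i k l n : Fin N, ∑ j, ∑ b, R (i, j) (l, b) * Ψ (b, k) (j, n) =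
      if i = n ∧ k = l then 1 else 0) ∧
  (∀ i k l n : Fin N, ∑ j, ∑ b, Ψ (i, j) (l, b) * R (b, k) (j, n) =
      if i = n ∧ k = l then 1 else 0)

/-- The generators `R₁, …, R_{n−1}` (1-based) of the Hecke-algebra image inside
`End(V^{⊗k})`, as a subset of `Mat_{N^k}`. -/
def genSet {α : Type*} [Semiring α] (N k n : ℕ)
    (R : Matrix (Fin N × Fin N) (Fin N × Fin N) α) :
    Set (Matrix (Fin k → Fin N) (Fin k → Fin N) α) :=
  {X | ∃ i : ℕ, i + 1 < n ∧ X = opAt N k R i}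

/-- The left ideal of `A` generated by the entries of `D`. -/
def entryIdeal (A : Type*) [Ring A] {N : ℕ} (D : Matrix (Fin N) (Fin N) A) :
    Submodule A A :=
  Submodule.span A {x : A | ∃ i j : Fin N, x = D i j}

/-- The normally ordered monomial `:L̂_{⟨1→k⟩}: = M_{⟨1→k⟩} D_{⟨k→1⟩} ∏_{s=1}^{k} J_s⁻¹`. -/
def normOrd {α : Type*} [Semiring α] (N k : ℕ)
    (R Rinv : Matrix (Fin N × Fin N) (Fin N × Fin N) α)
    (M D : Matrix (Fin N) (Fin N) α) (n : ℕ) :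
    Matrix (Fin k → Fin N) (Fin k → Fin N) α :=
  ovProd N k R Rinv M n * ovProdRev N k R Rinv D n *
    ((List.range n).map (fun s => JMup N k Rinv 0 s)).prod

/-- The embedding of an operator on `V^{⊗κ}` into operators on `V^{⊗k}`, acting in the tensor
factors selected by `e`. -/
def siteEmb {α κ : Type*} [Semiring α] {N k : ℕ} (e : κ → Fin k)
    (M : Matrix (κ → Fin N) (κ → Fin N) α) : Matrix (Fin k → Fin N) (Fin k → Fin N) α :=
  open Classical in
  Matrix.of fun a b => if ∀ l, l ∉ Set.range e → a l = b l then M (a ∘ e) (b ∘ e) else 0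

theorem siteEmb_mul {α κ : Type*} [Semiring α] [Fintype κ] [DecidableEq κ] {N k : ℕ}
    {e : κ → Fin k} (he : e.Injective) (M M' : Matrix (κ → Fin N) (κ → Fin N) α) :
    siteEmb e M * siteEmb e M' = siteEmb e (M * M') := by
  classical
  ext a b
  simp only [siteEmb, Matrix.mul_apply, Matrix.of_apply]
  split_ifs with hab
  · symm
    refine Finset.sum_of_injOn (fun d => Function.extend e d a) ?_ (by simp) ?_ ?_
    · intro d _ d' _ h
      funext x
      simpa [he.extend_apply] using congrFun h (e x)
    · intro c _ hc
      have : ¬ ∀ l, l ∉ Set.range e → a l = c l := by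
        intro h
        refine hc ⟨c ∘ e, by simp, ?_⟩
        funext l
        by_cases hl : l ∈ Set.range e
        · obtain ⟨x, rfl⟩ := hl
          simp [he.extend_apply]
        · simp only [Function.extend_apply' _ _ _ hl]
          exact h l hl
      rw [if_neg this, zero_mul]
    · intro d _
      have h0 : ∀ l, l ∉ Set.range e → Function.extend e d a l = a l := fun l hl =>
        Function.extend_apply' _ _ _ hl
      have h1 : Function.extend e d a ∘ e = d := funext fun x => he.extend_apply _ _ _
      rw [if_pos fun l hl => (h0 l hl).symm, if_pos fun l hl => (h0 l hl).trans (hab l hl), h1]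
  · refine Finset.sum_eq_zero fun c _ => ?_
    by_cases h : ∀ l, l ∉ Set.range e → a l = c l
    · rw [if_pos h, if_neg fun h' => hab fun l hl => (h l hl).trans (h' l hl), mul_zero]
    · rw [if_neg h, zero_mul]

theorem siteEmb_mul_apply_of_disjoint {α κ κ' : Type*} [Semiring α] {N k : ℕ}
    {e : κ → Fin k} {e' : κ' → Fin k} (hd : ∀ x y, e x ≠ e' y)
    (M : Matrix (κ → Fin N) (κ → Fin N) α) (M' : Matrix (κ' → Fin N) (κ' → Fin N) α)
    (a b : Fin k → Fin N) [Decidable (∀ l, l ∉ Set.range e → l ∉ Set.range e' → a l = b l)] :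
    (siteEmb e M * siteEmb e' M') a b =
      if ∀ l, l ∉ Set.range e → l ∉ Set.range e' → a l = b l then
        M (a ∘ e) (b ∘ e) * M' (a ∘ e') (b ∘ e') else 0 := by
  classical
  simp only [siteEmb, Matrix.mul_apply, Matrix.of_apply]
  have hd' : ∀ x, e x ∉ Set.range e' := fun x ⟨y, hy⟩ => hd x y hy.symm
  have hd'' : ∀ y, e' y ∉ Set.range e := fun y ⟨x, hx⟩ => hd x y hx
  split_ifs with hab
  · rw [Finset.sum_eq_single (fun l => if l ∈ Set.range e then b l else a l)]
    · rw [if_pos fun l hl => by simp only [if_neg hl], if_pos fun l hl => ?_]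
      · congr 2
        · funext x
          simp
        · funext y
          simp only [Function.comp_apply, if_neg (hd'' y)]
      · by_cases h : l ∈ Set.range e
        · simp only [if_pos h]
        · simp only [if_neg h]
          exact hab l h hl
    · intro c _ hc
      by_cases h : ∀ l, l ∉ Set.range e → a l = c l
      · rw [if_pos h, if_neg (fun h' => hc ?_), mul_zero]
        funext l
        by_cases hl : l ∈ Set.range e
        · obtain ⟨x, rfl⟩ := hl
          simpa using h' _ (hd' x)
        · simp only [if_neg hl]
          exact (h l hl).symm
      · rw [if_neg h, zero_mul]
    · simp
  · refine Finset.sum_eq_zero fun c _ => ?_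
    by_cases h : ∀ l, l ∉ Set.range e → a l = c l
    · rw [if_pos h, if_neg fun h' => hab fun l hl hl' => (h l hl).trans (h' l hl'), mul_zero]
    · rw [if_neg h, zero_mul]

theorem commute_siteEmb {α κ κ' : Type*} [Semiring α] {N k : ℕ}
    {e : κ → Fin k} {e' : κ' → Fin k} (hd : ∀ x y, e x ≠ e' y)
    {M : Matrix (κ → Fin N) (κ → Fin N) α} {M' : Matrix (κ' → Fin N) (κ' → Fin N) α}
    (hM : ∀ i j i' j', Commute (M i j) (M' i' j')) :
    Commute (siteEmb e M) (siteEmb e' M') := by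
  classical
  ext a b
  rw [siteEmb_mul_apply_of_disjoint hd, siteEmb_mul_apply_of_disjoint fun x y => (hd y x).symm]
  rw [(hM _ _ _ _).eq]
  refine if_congr ⟨fun h l h1 h2 => h l h2 h1, fun h l h1 h2 => h l h2 h1⟩ rfl rfl

/-- The inclusion of `m` consecutive tensor factors starting at position `i`. -/
def window {k : ℕ} (m i : ℕ) (h : i + m ≤ k) (j : Fin m) : Fin k :=
  ⟨i + j, by omega⟩

theorem window_injective {k m i : ℕ} (h : i + m ≤ k) : (window m i h).Injective := by
  intro x y hxy
  simp only [window, Fin.mk.injEq] at hxy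
  exact Fin.ext (by omega)

theorem notMem_range_window {k m i : ℕ} (h : i + m ≤ k) (l : Fin k) :
    l ∉ Set.range (window m i h) ↔ ((l : ℕ) < i ∨ i + m ≤ l) := by
  simp only [Set.mem_range, window, Fin.ext_iff, not_exists]
  refine ⟨fun hl => ?_, fun hl x hx => by omega⟩
  by_contra! hc
  exact hl ⟨l - i, by omega⟩ (by simp; omega)

theorem opAt_eq_siteEmb {α : Type*} [Semiring α] {N k m i j : ℕ}
    (R : Matrix (Fin N × Fin N) (Fin N × Fin N) α) (h : i + m ≤ k) (hj : j + 1 < m) :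
    opAt N k R (i + j) = siteEmb (window m i h) (opAt N m R j) := by
  classical
  ext a b
  simp only [opAt, siteEmb, dif_pos hj, dif_pos (show i + j + 1 < k by omega), Matrix.of_apply,
    notMem_range_window]
  by_cases hl : ∀ l : Fin k, (l : ℕ) ≠ i + j → (l : ℕ) ≠ i + j + 1 → a l = b l
  · rw [if_pos hl, if_pos fun l _ => hl l (by omega) (by omega), if_pos]
    · rfl
    · intro l h1 h2
      exact hl _ (by simp [window]; omega) (by simp [window]; omega)
  · rw [if_neg hl]
    by_cases h1 : ∀ l : Fin k, (l : ℕ) < i ∨ i + m ≤ l → a l = b l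
    · rw [if_pos h1, if_neg]
      intro h2
      refine hl fun l h3 h4 => ?_
      by_cases hw : (l : ℕ) < i ∨ i + m ≤ l
      · exact h1 l hw
      · have := h2 ⟨l - i, by omega⟩ (by simp; omega) (by simp; omega)
        have hli : window m i h ⟨l - i, by omega⟩ = l := Fin.ext (by simp [window]; omega)
        simpa only [Function.comp_apply, hli] using this
    · rw [if_neg h1]

theorem matAt_zero_eq_siteEmb {α : Type*} [Semiring α] {N k : ℕ}
    (X : Matrix (Fin N) (Fin N) α) (h : 0 + 1 ≤ k) :
    matAt N k X 0 = siteEmb (window 1 0 h) (matAt N 1 X 0) := by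
  classical
  ext a b
  simp only [matAt, siteEmb, dif_pos (show 0 < k by omega), dif_pos (show 0 < 1 by omega),
    Matrix.of_apply, notMem_range_window]
  rw [if_pos (show ∀ l : Fin 1, (l : ℕ) ≠ 0 → (a ∘ window 1 0 h) l = (b ∘ window 1 0 h) l from
    fun l hl => absurd l.2 (by omega))]
  refine if_congr ⟨fun h l hl => h l (by omega), fun h l hl => h l (by omega)⟩ rfl rfl

theorem opAt_one {α : Type*} [Semiring α] (N k i : ℕ) :
    opAt N k (1 : Matrix (Fin N × Fin N) (Fin N × Fin N) α) i = 1 := by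
  unfold opAt
  split_ifs with h
  · ext a b
    simp only [Matrix.of_apply, Matrix.one_apply, ← ite_and, Prod.mk.injEq]
    refine if_congr ⟨fun hab => ?_, fun hab => by simp [hab]⟩ rfl rfl
    funext l
    by_cases h1 : (l : ℕ) = i
    · rw [show l = ⟨i, by omega⟩ from Fin.ext h1]
      exact hab.2.1
    · by_cases h2 : (l : ℕ) = i + 1
      · rw [show l = ⟨i + 1, h⟩ from Fin.ext h2]
        exact hab.2.2
      · exact hab.1 l h1 h2
  · rfl

theorem opAt_two_mul {α : Type*} [Semiring α] {N : ℕ}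
    (R S : Matrix (Fin N × Fin N) (Fin N × Fin N) α) :
    opAt N 2 R 0 * opAt N 2 S 0 = opAt N 2 (R * S) 0 := by
  ext a b
  have h (l : Fin 2) : (l : ℕ) ≠ 0 → (l : ℕ) = 0 + 1 := by omega
  simp only [opAt, Matrix.mul_apply, zero_add, Nat.one_lt_ofNat, dite_true, Matrix.of_apply]
  simp only [zero_add] at h
  have h' (a b : Fin 2 → Fin N) :
      ∀ l : Fin 2, (l : ℕ) ≠ 0 → (l : ℕ) ≠ 1 → a l = b l := fun l h0 h1 => absurd (h l h0) h1
  simp only [if_pos (h' _ _)]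
  exact Fintype.sum_equiv (finTwoArrowEquiv (Fin N)) _ _ fun c => rfl

theorem opAt_mul_eq_one {α : Type*} [Semiring α] {N k i : ℕ}
    {R S : Matrix (Fin N × Fin N) (Fin N × Fin N) α} (h : R * S = 1) :
    opAt N k R i * opAt N k S i = 1 := by
  by_cases hi : i + 2 ≤ k
  · have key (T : Matrix (Fin N × Fin N) (Fin N × Fin N) α) :=
      opAt_eq_siteEmb (i := i) (j := 0) T hi (by omega)
    simp only [add_zero] at key
    rw [key, key, siteEmb_mul (window_injective hi), opAt_two_mul, ← key, h, opAt_one]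
  · simp only [opAt, dif_neg (show ¬ i + 1 < k by omega), mul_one]

theorem opAt_braid {α : Type*} [Semiring α] {N k i : ℕ}
    {R : Matrix (Fin N × Fin N) (Fin N × Fin N) α}
    (h : opAt N 3 R 0 * opAt N 3 R 1 * opAt N 3 R 0 =
      opAt N 3 R 1 * opAt N 3 R 0 * opAt N 3 R 1) (hi : i + 3 ≤ k) :
    opAt N k R i * opAt N k R (i + 1) * opAt N k R i =
      opAt N k R (i + 1) * opAt N k R i * opAt N k R (i + 1) := by
  have h0 := opAt_eq_siteEmb (i := i) (j := 0) R hi (by omega)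
  have h1 := opAt_eq_siteEmb (i := i) (j := 1) R hi (by omega)
  rw [add_zero] at h0
  simp only [h0, h1, siteEmb_mul (window_injective hi), h]

theorem opAt_toA {A : Type*} [Ring A] [Algebra ℂ A] (N k : ℕ)
    (R : Matrix (Fin N × Fin N) (Fin N × Fin N) ℂ) (i : ℕ) :
    opAt N k (toA A R) i = toA A (opAt N k R i) := by
  unfold opAt toA
  split_ifs with h
  · ext a b
    simp only [Matrix.of_apply, Matrix.map_apply]
    split_ifs <;> simp
  · simp

theorem toA_mul {A ι : Type*} [Ring A] [Algebra ℂ A] [Fintype ι] (X Y : Matrix ι ι ℂ) :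
    toA A (X * Y) = toA A X * toA A Y :=
  Matrix.map_mul

theorem toA_one {A ι : Type*} [Ring A] [Algebra ℂ A] [DecidableEq ι] :
    toA A (1 : Matrix ι ι ℂ) = 1 := by
  simp [toA]

theorem commute_opAt_toA {A : Type*} [Ring A] [Algebra ℂ A] {N k i j : ℕ}
    (R S : Matrix (Fin N × Fin N) (Fin N × Fin N) ℂ) (hij : i + 2 ≤ j) (hj : j + 2 ≤ k) :
    Commute (opAt N k (toA A R) i) (opAt N k (toA A S) j) := by
  have hi : i + 2 ≤ k := by omega
  have h0 := opAt_eq_siteEmb (i := i) (j := 0) (toA A R) hi (by omega)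
  have h1 := opAt_eq_siteEmb (i := j) (j := 0) (toA A S) hj (by omega)
  rw [add_zero] at h0 h1
  rw [h0, h1]
  refine commute_siteEmb (fun x y => ?_) fun a b c d => ?_
  · simp only [window, ne_eq, Fin.mk.injEq]
    omega
  · rw [opAt_toA]
    exact Algebra.commutes _ _

theorem commute_opAt_toA_matAt {A : Type*} [Ring A] [Algebra ℂ A] {N k i : ℕ}
    (R : Matrix (Fin N × Fin N) (Fin N × Fin N) ℂ) (X : Matrix (Fin N) (Fin N) A)
    (hi : 1 ≤ i) (hk : i + 2 ≤ k) :
    Commute (opAt N k (toA A R) i) (matAt N k X 0) := by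
  have h0 := opAt_eq_siteEmb (i := i) (j := 0) (toA A R) hk (by omega)
  rw [add_zero] at h0
  rw [h0, matAt_zero_eq_siteEmb X (by omega)]
  refine commute_siteEmb (fun x y => ?_) fun a b c d => ?_
  · simp only [window, ne_eq, Fin.mk.injEq]
    omega
  · rw [opAt_toA]
    exact Algebra.commutes _ _

section ShiftedCopies

variable {A : Type*} [Ring A] [Algebra ℂ A] {N t : ℕ}
  {R Rinv : Matrix (Fin N × Fin N) (Fin N × Fin N) ℂ}

theorem commute_opAt_ovCopy_of_lt (X : Matrix (Fin N) (Fin N) A) {m i : ℕ} (hm : m < i)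
    (hi : i + 2 ≤ t) :
    Commute (opAt N t (toA A R) i) (ovCopy N t (toA A R) (toA A Rinv) X m) := by
  induction m with
  | zero => exact commute_opAt_toA_matAt R X hm hi
  | succ m ih =>
    exact ((commute_opAt_toA R R (by omega) hi).symm.mul_right (ih (by omega))).mul_right
      (commute_opAt_toA Rinv R (by omega) hi).symm

theorem commute_opAt_ovCopy_of_gt (hRinv : R * Rinv = 1 ∧ Rinv * R = 1) (hbraid : IsBraid N R)
    (X : Matrix (Fin N) (Fin N) A) {m i : ℕ} (hi : i + 2 ≤ m) (hm : m < t) :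
    Commute (opAt N t (toA A R) i) (ovCopy N t (toA A R) (toA A Rinv) X m) := by
  induction m, hi using Nat.le_induction with
  | base =>
    have hb : opAt N t (toA A R) i * opAt N t (toA A R) (i + 1) * opAt N t (toA A R) i =
        opAt N t (toA A R) (i + 1) * opAt N t (toA A R) i * opAt N t (toA A R) (i + 1) := by
      refine opAt_braid ?_ (by omega)
      simp only [opAt_toA, ← toA_mul]
      exact congrArg _ hbraid
    have h1 : toA A R * toA A Rinv = 1 := by rw [← toA_mul, hRinv.1, toA_one]
    have h2 : toA A Rinv * toA A R = 1 := by rw [← toA_mul, hRinv.2, toA_one]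
    have hx : Commute (opAt N t (toA A R) (i + 1)) (ovCopy N t (toA A R) (toA A Rinv) X i) :=
      commute_opAt_ovCopy_of_lt X (by omega) (by omega)
    have e1 := opAt_mul_eq_one (k := t) (i := i) h1
    have e2 := opAt_mul_eq_one (k := t) (i := i + 1) h1
    have e3 := opAt_mul_eq_one (k := t) (i := i) h2
    have e4 := opAt_mul_eq_one (k := t) (i := i + 1) h2
    simp only [ovCopy]
    generalize ovCopy N t (toA A R) (toA A Rinv) X i = x at *
    generalize opAt N t (toA A R) i = r at *
    generalize opAt N t (toA A R) (i + 1) = r' at *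
    generalize opAt N t (toA A Rinv) i = s at *
    generalize opAt N t (toA A Rinv) (i + 1) = s' at *
    have hg : SemiconjBy (r' * r) r' r := hb.symm.trans (mul_assoc _ _ _)
    let u : (Matrix (Fin t → Fin N) (Fin t → Fin N) A)ˣ := ⟨r', s', e2, e4⟩ * ⟨r, s, e1, e3⟩
    have hs : SemiconjBy (s * s') r r' := SemiconjBy.units_inv_symm_left (a := u) hg
    calc r * (r' * (r * x * s) * s') = r * (r' * r) * x * (s * s') := by simp only [mul_assoc]
      _ = r' * r * (r' * x) * (s * s') := by rw [← hg.eq]; simp only [mul_assoc]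
      _ = r' * r * x * (r' * (s * s')) := by rw [hx.eq]; simp only [mul_assoc]
      _ = r' * (r * x * s) * s' * r := by rw [← hs.eq]; simp only [mul_assoc]
  | succ m hm' ih =>
    exact ((commute_opAt_toA R R hm' (by omega)).mul_right (ih (by omega))).mul_right
      (commute_opAt_toA R Rinv hm' (by omega))

theorem semiconjBy_list_prod {M ι : Type*} [Monoid M] {g : M} {x y : ι → M} (l : List ι)
    (h : ∀ i ∈ l, SemiconjBy g (x i) (y i)) :
    SemiconjBy g (l.map x).prod (l.map y).prod := by
  induction l with
  | nil => exact SemiconjBy.one_right g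
  | cons i l ih =>
    simp only [List.map_cons, List.prod_cons]
    exact (h i (by simp)).mul_right (ih fun j hj => h j (by simp [hj]))

theorem commute_list_prod_left {M ι : Type*} [Monoid M] {x : M} {r : ι → M} (l : List ι)
    (h : ∀ i ∈ l, Commute (r i) x) : Commute (l.map r).prod x :=
  Commute.list_prod_left _ _ (by simpa using h)

theorem list_map_prod_mul_reverse_map_prod {M ι : Type*} [Monoid M] {r s : ι → M}
    (h : ∀ i, r i * s i = 1) (l : List ι) :
    (l.map r).prod * (l.reverse.map s).prod = 1 := by
  induction l with
  | nil => simp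
  | cons i l ih =>
    simp only [List.map_cons, List.prod_cons, List.reverse_cons, List.map_append,
      List.prod_append, List.map_nil, List.prod_nil, mul_one]
    rw [mul_assoc, ← mul_assoc _ _ (s i), ih, one_mul, h]

/-- Conjugation by a long ascending product of the `R_i` shifts a copy by one position. -/
theorem semiconjBy_ovCopy_succ (hRinv : R * Rinv = 1 ∧ Rinv * R = 1) (hbraid : IsBraid N R)
    (X : Matrix (Fin N) (Fin N) A) {c p j : ℕ} (hj : j < p) (ht : c + p < t) :
    SemiconjBy ((List.range' c p).map (opAt N t (toA A R))).prod
      (ovCopy N t (toA A R) (toA A Rinv) X (c + j))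
      (ovCopy N t (toA A R) (toA A Rinv) X (c + j + 1)) := by
  obtain ⟨d, rfl⟩ : ∃ d, p = j + (d + 1) := ⟨p - j - 1, by omega⟩
  rw [← List.range'_append_1, List.range'_succ]
  simp only [List.map_append, List.map_cons, List.prod_append, List.prod_cons]
  refine SemiconjBy.mul_left (y := ovCopy N t (toA A R) (toA A Rinv) X (c + j + 1)) ?_
    (SemiconjBy.mul_left (y := ovCopy N t (toA A R) (toA A Rinv) X (c + j)) ?_ ?_)
  · refine commute_list_prod_left _ fun i hi => ?_
    rw [List.mem_range'_1] at hi
    exact commute_opAt_ovCopy_of_gt hRinv hbraid X (by omega) (by omega)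
  · have h2 : toA A Rinv * toA A R = 1 := by rw [← toA_mul, hRinv.2, toA_one]
    simp only [SemiconjBy, ovCopy, mul_assoc, opAt_mul_eq_one h2, mul_one]
  · refine commute_list_prod_left _ fun i hi => ?_
    rw [List.mem_range'_1] at hi
    exact commute_opAt_ovCopy_of_lt X (by omega) (by omega)

end ShiftedCopies

/-- The shift identity
`X⁽¹⁾_{⟨k+1⟩}⋯X⁽ᵖ⁾_{⟨k+p⟩} = R_{k→(k+p−1)} · X⁽¹⁾_{⟨k⟩}⋯X⁽ᵖ⁾_{⟨k+p−1⟩} · R⁻¹_{(k+p−1)→k}`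
for arbitrary matrices `X⁽ʲ⁾`; it only needs the braid relation for `R`. -/
theorem stmt5 {A : Type*} [Ring A] [Algebra ℂ A] (N : ℕ) (hN : 1 ≤ N)
    (R Rinv : Matrix (Fin N × Fin N) (Fin N × Fin N) ℂ)
    (hRinv : R * Rinv = 1 ∧ Rinv * R = 1)
    (hbraid : IsBraid N R)
    (p k t : ℕ) (hp : 1 ≤ p) (hk : 1 ≤ k) (ht : k + p ≤ t)
    (X : Fin p → Matrix (Fin N) (Fin N) A) :
    ((List.finRange p).map
        (fun j => ovCopy N t (toA A R) (toA A Rinv) (X j) (k + (j : ℕ)))).prod =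
      ((List.range' (k - 1) p).map (opAt N t (toA A R))).prod *
        ((List.finRange p).map
          (fun j => ovCopy N t (toA A R) (toA A Rinv) (X j) (k - 1 + (j : ℕ)))).prod *
        ((List.range' (k - 1) p).reverse.map (opAt N t (toA A Rinv))).prod := by
  have h1 : toA A R * toA A Rinv = 1 := by rw [← toA_mul, hRinv.1, toA_one]
  obtain ⟨c, rfl⟩ : ∃ c, k = c + 1 := ⟨k - 1, by omega⟩
  simp only [Nat.add_sub_cancel]
  have h := semiconjBy_list_prod (List.finRange p) fun j _ =>
    semiconjBy_ovCopy_succ (t := t) hRinv hbraid (X j) (c := c) j.2 (by omega)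
  rw [h.eq, mul_assoc, list_map_prod_mul_reverse_map_prod fun i => opAt_mul_eq_one h1, mul_one]
  simp only [add_right_comm c 1]
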